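/- For any point placement P of n ≥ 3 points, setting N = C(n,3), B = Σ_T β_T, and G = Σ_T γ_T (sums over all 3-element subsets T of P), the inequality Σ_T β_T·γ_T ≤ B·G/N + √((Σ_T β_T² − B²/N)·(Σ_T γ_T² − G²/N)) holds; consequently 4·P₅(P) ≥ 4·C(n,5) − B·G/N − √((Σ_T β_T² − B²/N)·(Σ_T γ_T² − G²/N)). -/

import Mathlib

open Finset

/-- A finite set of points in the plane is in *general position* if no three of
its points are collinear. -/
def GenPos (P : Finset (ℝ × ℝ)) : Prop :=
  ∀ x ∈ P, ∀ y ∈ P, ∀ z ∈ P, x ≠ y → x ≠ z → y ≠ z →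
    ¬ Collinear ℝ ({x, y, z} : Set (ℝ × ℝ))

/-- A finite set of points is in *convex position* if every point of it is an
extreme point of its convex hull. -/
def ConvexPos (S : Finset (ℝ × ℝ)) : Prop :=
  ∀ x ∈ S, x ∈ Set.extremePoints ℝ (convexHull ℝ (S : Set (ℝ × ℝ)))

open scoped Classical in
/-- Number of `k`-element subsets of `P` that are in convex position. -/
noncomputable def convexPosCount (P : Finset (ℝ × ℝ)) (k : ℕ) : ℕ :=
  ((P.powersetCard k).filter fun S => ConvexPos S).card

/-- `mu k n` is the minimum number of `k`-element subsets in convex position over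
all placements of `n` points in general position. -/
noncomputable def mu (k n : ℕ) : ℕ :=
  sInf {m | ∃ P : Finset (ℝ × ℝ), GenPos P ∧ P.card = n ∧ convexPosCount P k = m}

/-- `x` is a γ-point of `T` if `T ∪ {x}` is in convex position. -/
def IsGammaPt (T : Finset (ℝ × ℝ)) (x : ℝ × ℝ) : Prop :=
  ConvexPos (insert x T)

/-- `x` is a β-point of `T` if `T ∪ {x}` is not in convex position and `x` does not
lie in the convex hull of `T`. -/
def IsBetaPt (T : Finset (ℝ × ℝ)) (x : ℝ × ℝ) : Prop :=
  ¬ ConvexPos (insert x T) ∧ x ∉ convexHull ℝ (T : Set (ℝ × ℝ))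

open scoped Classical in
/-- `γ_T`: number of γ-points of `T` among the points of `P \ T`. -/
noncomputable def gammaCount (P T : Finset (ℝ × ℝ)) : ℕ :=
  ((P \ T).filter fun x => IsGammaPt T x).card

open scoped Classical in
/-- `β_T`: number of β-points of `T` among the points of `P \ T`. -/
noncomputable def betaCount (P T : Finset (ℝ × ℝ)) : ℕ :=
  ((P \ T).filter fun x => IsBetaPt T x).card

open scoped Classical in
/-- Number of `k`-element subsets of `P` whose convex hull has exactly `j`
extreme points. -/
noncomputable def hullCount (P : Finset (ℝ × ℝ)) (k j : ℕ) : ℕ :=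
  ((P.powersetCard k).filter fun S =>
    (Set.extremePoints ℝ (convexHull ℝ (S : Set (ℝ × ℝ)))).ncard = j).card

/-- `x` and `y` lie strictly on the same side of the line through `p` and `q`. -/
def SameSide (p q x y : ℝ × ℝ) : Prop :=
  0 < ((q.1 - p.1) * (x.2 - p.2) - (q.2 - p.2) * (x.1 - p.1)) *
      ((q.1 - p.1) * (y.2 - p.2) - (q.2 - p.2) * (y.1 - p.1))

/-- `x` and `y` lie in the same region with respect to `T`: for each pair of
distinct points of `T`, they lie strictly on the same side of the line through them. -/
def SameRegion (T : Finset (ℝ × ℝ)) (x y : ℝ × ℝ) : Prop :=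
  ∀ p ∈ T, ∀ q ∈ T, p ≠ q → SameSide p q x y

open scoped Classical in
/-- Number of 2-element subsets `{x, y}` of `P \ T` such that `x` and `y` are both
γ-points of `T` lying in the same region with respect to `T`. -/
noncomputable def gammaSamePairs (P T : Finset (ℝ × ℝ)) : ℕ :=
  (((P \ T).powersetCard 2).filter fun S =>
    (∀ x ∈ S, IsGammaPt T x) ∧ ∀ x ∈ S, ∀ y ∈ S, x ≠ y → SameRegion T x y).card

open scoped Classical in
/-- Number of 2-element subsets `{x, y}` of `P \ T` such that `x` and `y` are both
γ-points of `T` lying in distinct regions with respect to `T`. -/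
noncomputable def gammaDiffPairs (P T : Finset (ℝ × ℝ)) : ℕ :=
  (((P \ T).powersetCard 2).filter fun S =>
    (∀ x ∈ S, IsGammaPt T x) ∧ ∀ x ∈ S, ∀ y ∈ S, x ≠ y → ¬ SameRegion T x y).card

open scoped Classical in
/-- Number of 2-element subsets `{x, y}` of `P \ T` such that `x` and `y` are both
β-points of `T` lying in the same region with respect to `T`. -/
noncomputable def betaSamePairs (P T : Finset (ℝ × ℝ)) : ℕ :=
  (((P \ T).powersetCard 2).filter fun S =>
    (∀ x ∈ S, IsBetaPt T x) ∧ ∀ x ∈ S, ∀ y ∈ S, x ≠ y → SameRegion T x y).card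

open scoped Classical in
/-- Number of 2-element subsets `{x, y}` of `P \ T` such that `x` and `y` are both
β-points of `T` lying in distinct regions with respect to `T`. -/
noncomputable def betaDiffPairs (P T : Finset (ℝ × ℝ)) : ℕ :=
  (((P \ T).powersetCard 2).filter fun S =>
    (∀ x ∈ S, IsBetaPt T x) ∧ ∀ x ∈ S, ∀ y ∈ S, x ≠ y → ¬ SameRegion T x y).card

/-- For four planar points `w, x, y, z` with orientation signs `p, q, r, t` of the triples
`wxy, wxz, wyz, xyz`, whether the `k`-th point lies in the triangle spanned by the others. -/
def insideOfSigns (p q r t : Bool) : Fin 4 → Bool :=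
  ![(p == r) && (p != q), (p != t) && (t == q), (p == r) && (r != t), (q == t) && (q != r)]

/-- The sign condition imposed by a three-term relation `a * f - b * e + c * d = 0`. -/
def plueckerSigns (a f b e c d : Bool) : Bool :=
  !(((a == f) != (b == e)) && ((a == f) == (c == d)))

/-- The sign condition imposed by the affine relation `p - q + r - t = 0`. -/
def affineSigns (p q r t : Bool) : Bool :=
  !((p != q) && (q != r) && (r != t))

/-- The pairs `(j, k)` such that, when `H j k` records whether the `k`-th of the four points other
than `j` is inside the triangle of the remaining ones, omitting `j` leaves a non-convex quadruple
in which `j.succAbove k` is not the inner point, and omitting `j.succAbove k` leaves a convex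
quadruple. -/
def betaGammaPairs (H : Fin 5 → Fin 4 → Bool) : Finset (Fin 5 × Fin 4) :=
  univ.filter fun p =>
    (∃ k, H p.1 k = true) ∧ H p.1 p.2 = false ∧ ∀ k, H (p.1.succAbove p.2) k = false

/-- The inside/outside table of five points computed from their ten orientation signs. -/
def insideTable (a012 a013 a014 a023 a024 a034 a123 a124 a134 a234 : Bool) :
    Fin 5 → Fin 4 → Bool :=
  ![insideOfSigns a123 a124 a134 a234, insideOfSigns a023 a024 a034 a234,
    insideOfSigns a013 a014 a034 a134, insideOfSigns a012 a014 a024 a124,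
    insideOfSigns a012 a013 a023 a123]

set_option synthInstance.maxHeartbeats 400000 in
set_option synthInstance.maxSize 2000 in
theorem four_le_card_betaGammaPairs_insideTable :
    ∀ a012 a013 a014 a023 a024 a034 a123 a124 a134 a234 : Bool,
      plueckerSigns a012 a034 a013 a024 a014 a023 → plueckerSigns a012 a134 a013 a124 a014 a123 →
      plueckerSigns a012 a234 a023 a124 a024 a123 → plueckerSigns a013 a234 a023 a134 a034 a123 →
      plueckerSigns a014 a234 a024 a134 a034 a124 →
      affineSigns a123 a124 a134 a234 → affineSigns a023 a024 a034 a234 →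
      affineSigns a013 a014 a034 a134 → affineSigns a012 a014 a024 a124 →
      affineSigns a012 a013 a023 a123 →
      (∃ j k, insideTable a012 a013 a014 a023 a024 a034 a123 a124 a134 a234 j k = true) →
      4 ≤ (betaGammaPairs
        (insideTable a012 a013 a014 a023 a024 a034 a123 a124 a134 a234)).card := by
  decide +kernel

/-- Twice the signed area of the triangle `a b c`. -/
def orient (a b c : ℝ × ℝ) : ℝ :=
  (b.1 - a.1) * (c.2 - a.2) - (b.2 - a.2) * (c.1 - a.1)

theorem collinear_of_orient_eq_zero {a b c : ℝ × ℝ} (h : orient a b c = 0) :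
    Collinear ℝ ({a, b, c} : Set (ℝ × ℝ)) := by
  unfold orient at h
  by_cases hab : b = a
  · subst hab
    simpa using collinear_pair ℝ b c
  rw [collinear_iff_of_mem (p₀ := a) (by simp)]
  refine ⟨b - a, ?_⟩
  simp only [Set.mem_insert_iff, Set.mem_singleton_iff, forall_eq_or_imp, forall_eq, vadd_eq_add]
  refine ⟨⟨0, by simp⟩, ⟨1, by simp⟩, ?_⟩
  by_cases h1 : b.1 - a.1 = 0
  · have h2 : b.2 - a.2 ≠ 0 := fun h2 => hab (Prod.ext (by linarith) (by linarith))
    refine ⟨(c.2 - a.2) / (b.2 - a.2), Prod.ext ?_ ?_⟩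
    · rw [h1] at h
      have : c.1 - a.1 = 0 := by
        have : (b.2 - a.2) * (c.1 - a.1) = 0 := by linarith
        exact (mul_eq_zero.1 this).resolve_left h2
      simp [h1]
      linarith
    · simp
      field_simp
      ring
  · refine ⟨(c.1 - a.1) / (b.1 - a.1), Prod.ext ?_ ?_⟩
    · simp
      field_simp
      ring
    · simp
      field_simp
      linarith

theorem mem_convexHull_triple {a b c x : ℝ × ℝ} :
    x ∈ convexHull ℝ ({a, b, c} : Set (ℝ × ℝ)) ↔
      ∃ u v w : ℝ, 0 ≤ u ∧ 0 ≤ v ∧ 0 ≤ w ∧ u + v + w = 1 ∧ u • a + v • b + w • c = x := by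
  constructor
  · intro h
    rw [convexHull_insert (by simp), convexHull_pair, convexJoin_singleton_left] at h
    simp only [Set.mem_iUnion] at h
    obtain ⟨y, ⟨s, t, hs, ht, hst, rfl⟩, p, q, hp, hq, hpq, rfl⟩ := h
    refine ⟨p, q * s, q * t, hp, by positivity, by positivity, ?_, ?_⟩
    · rw [add_assoc, ← mul_add, hst, mul_one, hpq]
    · simp only [smul_add, mul_smul, add_assoc]
  · rintro ⟨u, v, w, hu, hv, hw, h1, rfl⟩
    have hc := convex_convexHull ℝ ({a, b, c} : Set (ℝ × ℝ))
    have hs := subset_convexHull ℝ ({a, b, c} : Set (ℝ × ℝ))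
    have := hc.sum_mem (t := univ) (w := ![u, v, w]) (z := ![a, b, c])
      (by intro i _; fin_cases i <;> simpa) (by simpa [Fin.sum_univ_three] using h1)
      (by intro i _; fin_cases i <;> exact hs (by simp))
    simpa [Fin.sum_univ_three] using this

theorem mem_convexHull_triple_iff_orient {a b c x : ℝ × ℝ} (h₁ : orient x a b ≠ 0)
    (h₂ : orient x b c ≠ 0) (h₃ : orient x c a ≠ 0) :
    x ∈ convexHull ℝ ({a, b, c} : Set (ℝ × ℝ)) ↔
      decide (0 < orient x a b) = decide (0 < orient x b c) ∧
        decide (0 < orient x b c) = decide (0 < orient x c a) := by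
  have hsum : orient x a b + orient x b c + orient x c a = orient a b c := by
    unfold orient; ring
  rw [mem_convexHull_triple]
  constructor
  · rintro ⟨u, v, w, hu, hv, hw, h, rfl⟩
    obtain rfl : u = 1 - v - w := by linarith
    have e₁ : orient ((1 - v - w) • a + v • b + w • c) a b = w * orient a b c := by
      simp [orient]; ring
    have e₂ : orient ((1 - v - w) • a + v • b + w • c) b c = (1 - v - w) * orient a b c := by
      simp [orient]; ring
    have e₃ : orient ((1 - v - w) • a + v • b + w • c) c a = v * orient a b c := by
      simp [orient]; ring
    rw [e₁] at h₁
    rw [e₂] at h₂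
    rw [e₃] at h₃
    have hw' := lt_of_le_of_ne hw (left_ne_zero_of_mul h₁).symm
    have hu' := lt_of_le_of_ne hu (left_ne_zero_of_mul h₂).symm
    have hv' := lt_of_le_of_ne hv (left_ne_zero_of_mul h₃).symm
    simp only [e₁, e₂, e₃, mul_pos_iff_of_pos_left, hw', hu', hv', and_self]
  · intro h
    simp only [decide_eq_decide] at h
    have key : orient a b c ≠ 0 ∧ 0 ≤ orient x b c / orient a b c ∧
        0 ≤ orient x c a / orient a b c ∧ 0 ≤ orient x a b / orient a b c := by
      rw [← hsum]
      rcases h₁.lt_or_gt with h1 | h1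
      · have h2 := h₂.lt_of_le (not_lt.1 fun h' => h1.not_gt (h.1.2 h'))
        have h3 := h₃.lt_of_le (not_lt.1 fun h' => h2.not_gt (h.2.2 h'))
        exact ⟨by linarith, div_nonneg_of_nonpos h2.le (by linarith),
          div_nonneg_of_nonpos h3.le (by linarith), div_nonneg_of_nonpos h1.le (by linarith)⟩
      · have h2 := h.1.1 h1
        have h3 := h.2.1 h2
        exact ⟨by linarith, by positivity, by positivity, by positivity⟩
    obtain ⟨h0, hu, hv, hw⟩ := key
    refine ⟨_, _, _, hu, hv, hw, ?_, ?_⟩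
    · rw [← add_div, ← add_div, div_eq_one_iff_eq h0]
      linarith
    · ext
      · simp
        field_simp
        unfold orient; ring
      · simp
        field_simp
        unfold orient; ring

theorem mem_extremePoints_convexHull_finset_iff {E : Type*} [AddCommGroup E] [Module ℝ E]
    [TopologicalSpace E] [IsTopologicalAddGroup E] [T2Space E] [ContinuousSMul ℝ E]
    [LocallyConvexSpace ℝ E] [DecidableEq E] {S : Finset E} {x : E} (hx : x ∈ S) :
    x ∈ Set.extremePoints ℝ (convexHull ℝ (S : Set E)) ↔
      x ∉ convexHull ℝ (S.erase x : Set E) := by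
  have hsub : (S.erase x : Set E) ⊆ S := by simp
  constructor
  · intro h hmem
    rw [(convex_convexHull ℝ _).mem_extremePoints_iff_mem_sdiff_convexHull_sdiff] at h
    refine h.2 (convexHull_mono ?_ hmem)
    intro y hy
    exact ⟨subset_convexHull ℝ _ (hsub hy), by simpa using Finset.ne_of_mem_erase hy⟩
  · intro h
    by_contra hne
    have hcomp : IsCompact (convexHull ℝ (S : Set E)) := S.finite_toSet.isCompact_convexHull ℝ
    have hclosed : IsClosed (convexHull ℝ (S.erase x : Set E)) :=
      (S.erase x).finite_toSet.isClosed_convexHull ℝ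
    have hext : Set.extremePoints ℝ (convexHull ℝ (S : Set E)) ⊆ (S.erase x : Set E) := by
      intro y hy
      refine Finset.mem_coe.2 (Finset.mem_erase.2 ⟨?_, extremePoints_convexHull_subset hy⟩)
      rintro rfl
      exact hne hy
    have hx' : x ∈ closure (convexHull ℝ (Set.extremePoints ℝ (convexHull ℝ (S : Set E)))) := by
      rw [closure_convexHull_extremePoints hcomp (convex_convexHull ℝ _)]
      exact subset_convexHull ℝ _ hx
    exact h (closure_minimal (convexHull_mono hext) hclosed hx')

theorem decide_pos_neg {a : ℝ} (ha : a ≠ 0) : decide (0 < -a) = !decide (0 < a) := by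
  rcases ha.lt_or_gt with h | h <;> simp [h, h.le]

theorem decide_pos_beq {a b : ℝ} (ha : a ≠ 0) (hb : b ≠ 0) :
    (decide (0 < a) == decide (0 < b)) = decide (0 < a * b) := by
  rcases ha.lt_or_gt with h | h <;> rcases hb.lt_or_gt with h' | h' <;>
    simp [h, h', h.not_gt, h'.not_gt, mul_pos_of_neg_of_neg]

theorem plueckerSigns_of_eq {a f b e c d : ℝ} (ha : a ≠ 0) (hf : f ≠ 0) (hb : b ≠ 0) (he : e ≠ 0)
    (hc : c ≠ 0) (hd : d ≠ 0) (h : a * f - b * e + c * d = 0) :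
    plueckerSigns (decide (0 < a)) (decide (0 < f)) (decide (0 < b)) (decide (0 < e))
      (decide (0 < c)) (decide (0 < d)) = true := by
  rw [plueckerSigns, decide_pos_beq ha hf, decide_pos_beq hb he, decide_pos_beq hc hd]
  have haf := mul_ne_zero ha hf
  have hbe := mul_ne_zero hb he
  have hcd := mul_ne_zero hc hd
  rcases haf.lt_or_gt with h₁ | h₁ <;> rcases hbe.lt_or_gt with h₂ | h₂ <;>
    rcases hcd.lt_or_gt with h₃ | h₃ <;>
    first
      | (exfalso; linarith)
      | simp [h₁, h₂, h₃, h₁.not_gt, h₂.not_gt, h₃.not_gt]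

theorem affineSigns_of_eq {p q r t : ℝ} (hp : p ≠ 0) (hq : q ≠ 0) (hr : r ≠ 0) (ht : t ≠ 0)
    (h : p - q + r - t = 0) :
    affineSigns (decide (0 < p)) (decide (0 < q)) (decide (0 < r)) (decide (0 < t)) = true := by
  rw [affineSigns]
  rcases hp.lt_or_gt with h₁ | h₁ <;> rcases hq.lt_or_gt with h₂ | h₂ <;>
    rcases hr.lt_or_gt with h₃ | h₃ <;> rcases ht.lt_or_gt with h₄ | h₄ <;>
    first
      | (exfalso; linarith)
      | simp [h₁, h₂, h₃, h₄, h₁.not_gt, h₂.not_gt, h₃.not_gt, h₄.not_gt]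

theorem mem_convexHull_iff_insideOfSigns {g : Fin 4 → ℝ × ℝ}
    (hg : ∀ i j k, i < j → j < k → orient (g i) (g j) (g k) ≠ 0) (k : Fin 4) :
    g k ∈ convexHull ℝ (g '' {k}ᶜ) ↔
      insideOfSigns (decide (0 < orient (g 0) (g 1) (g 2))) (decide (0 < orient (g 0) (g 1) (g 3)))
        (decide (0 < orient (g 0) (g 2) (g 3))) (decide (0 < orient (g 1) (g 2) (g 3))) k
        = true := by
  have h₁ := hg 0 1 2 (by decide) (by decide)
  have h₂ := hg 0 1 3 (by decide) (by decide)
  have h₃ := hg 0 2 3 (by decide) (by decide)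
  have h₄ := hg 1 2 3 (by decide) (by decide)
  have key : ∀ k a b c : Fin 4, ({k}ᶜ : Set (Fin 4)) = {a, b, c} →
      orient (g k) (g a) (g b) ≠ 0 → orient (g k) (g b) (g c) ≠ 0 →
      orient (g k) (g c) (g a) ≠ 0 → (g k ∈ convexHull ℝ (g '' {k}ᶜ) ↔
        decide (0 < orient (g k) (g a) (g b)) = decide (0 < orient (g k) (g b) (g c)) ∧
        decide (0 < orient (g k) (g b) (g c)) = decide (0 < orient (g k) (g c) (g a))) := by
    intro k a b c hk ha hb hc
    rw [hk, Set.image_insert_eq, Set.image_pair]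
    exact mem_convexHull_triple_iff_orient ha hb hc
  have k₀ := key 0 1 2 3 (by ext i; fin_cases i <;> simp)
  have k₁ := key 1 0 2 3 (by ext i; fin_cases i <;> simp)
  have k₂ := key 2 0 1 3 (by ext i; fin_cases i <;> simp)
  have k₃ := key 3 0 1 2 (by ext i; fin_cases i <;> simp)
  rw [show orient (g 0) (g 3) (g 1) = -orient (g 0) (g 1) (g 3) by unfold orient; ring,
    decide_pos_neg h₂] at k₀
  rw [show orient (g 1) (g 0) (g 2) = -orient (g 0) (g 1) (g 2) by unfold orient; ring,
    show orient (g 1) (g 3) (g 0) = orient (g 0) (g 1) (g 3) by unfold orient; ring,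
    decide_pos_neg h₁] at k₁
  rw [show orient (g 2) (g 0) (g 1) = orient (g 0) (g 1) (g 2) by unfold orient; ring,
    show orient (g 2) (g 1) (g 3) = -orient (g 1) (g 2) (g 3) by unfold orient; ring,
    show orient (g 2) (g 3) (g 0) = orient (g 0) (g 2) (g 3) by unfold orient; ring,
    decide_pos_neg h₄] at k₂
  rw [show orient (g 3) (g 0) (g 1) = orient (g 0) (g 1) (g 3) by unfold orient; ring,
    show orient (g 3) (g 1) (g 2) = orient (g 1) (g 2) (g 3) by unfold orient; ring,
    show orient (g 3) (g 2) (g 0) = -orient (g 0) (g 2) (g 3) by unfold orient; ring,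
    decide_pos_neg h₃] at k₃
  replace k₀ := k₀ h₁ h₃ (neg_ne_zero.2 h₂)
  replace k₁ := k₁ (neg_ne_zero.2 h₁) h₄ h₂
  replace k₂ := k₂ h₁ (neg_ne_zero.2 h₄) h₃
  replace k₃ := k₃ h₂ h₄ (neg_ne_zero.2 h₃)
  have signs : ∀ p q r t : Bool,
      ((p = r ∧ r = !q) ↔ insideOfSigns p q r t 0 = true) ∧
      (((!p) = t ∧ t = q) ↔ insideOfSigns p q r t 1 = true) ∧
      ((p = !t ∧ (!t) = r) ↔ insideOfSigns p q r t 2 = true) ∧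
      ((q = t ∧ t = !r) ↔ insideOfSigns p q r t 3 = true) := by decide
  obtain ⟨s₀, s₁, s₂, s₃⟩ := signs (decide (0 < orient (g 0) (g 1) (g 2)))
    (decide (0 < orient (g 0) (g 1) (g 3))) (decide (0 < orient (g 0) (g 2) (g 3)))
    (decide (0 < orient (g 1) (g 2) (g 3)))
  fin_cases k
  exacts [k₀.trans s₀, k₁.trans s₁, k₂.trans s₂, k₃.trans s₃]

open scoped Classical in
theorem four_le_card_betaGammaPairs {f : Fin 5 → ℝ × ℝ}
    (hf : ∀ i j k, i < j → j < k → orient (f i) (f j) (f k) ≠ 0)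
    (h : ∃ (j : Fin 5) (k : Fin 4),
      f (j.succAbove k) ∈ convexHull ℝ ((f ∘ j.succAbove) '' {k}ᶜ)) :
    4 ≤ (betaGammaPairs fun j k =>
      decide (f (j.succAbove k) ∈ convexHull ℝ ((f ∘ j.succAbove) '' {k}ᶜ))).card := by
  set s : Fin 5 → Fin 5 → Fin 5 → Bool :=
    fun i j k => decide (0 < orient (f i) (f j) (f k)) with hs
  have htable : (fun j k =>
      decide (f (j.succAbove k) ∈ convexHull ℝ ((f ∘ j.succAbove) '' {k}ᶜ))) =
      insideTable (s 0 1 2) (s 0 1 3) (s 0 1 4) (s 0 2 3) (s 0 2 4) (s 0 3 4) (s 1 2 3) (s 1 2 4)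
        (s 1 3 4) (s 2 3 4) := by
    funext j k
    have hmem := mem_convexHull_iff_insideOfSigns (g := f ∘ j.succAbove)
      (fun a b c hab hbc => hf _ _ _ (Fin.strictMono_succAbove j hab)
        (Fin.strictMono_succAbove j hbc)) k
    rw [Bool.eq_iff_iff, decide_eq_true_iff]
    refine hmem.trans (Bool.eq_iff_iff.1 ?_)
    fin_cases j <;> rfl
  obtain ⟨j, k, hjk⟩ := h
  have hjk' : insideTable (s 0 1 2) (s 0 1 3) (s 0 1 4) (s 0 2 3) (s 0 2 4) (s 0 3 4) (s 1 2 3)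
      (s 1 2 4) (s 1 3 4) (s 2 3 4) j k = true := by
    rw [← htable]
    exact decide_eq_true hjk
  rw [htable]
  refine four_le_card_betaGammaPairs_insideTable _ _ _ _ _ _ _ _ _ _ ?_ ?_ ?_ ?_ ?_ ?_ ?_ ?_ ?_ ?_
    ⟨j, k, hjk'⟩
  all_goals first
    | apply plueckerSigns_of_eq
    | apply affineSigns_of_eq
  all_goals first
    | (apply hf <;> decide)
    | (unfold orient; ring)

theorem coe_image_univ_erase {α ι : Type*} [Fintype ι] [DecidableEq α] {g : ι → α}
    (hg : Function.Injective g) (k : ι) :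
    (((univ.image g).erase (g k) : Finset α) : Set α) = g '' {k}ᶜ := by
  rw [coe_erase, coe_image, coe_univ, Set.image_compl_eq_range_sdiff_image hg, Set.image_univ,
    Set.image_singleton]

theorem image_univ_erase_succAbove {α : Type*} [DecidableEq α] {n : ℕ} {f : Fin (n + 1) → α}
    (hf : Function.Injective f) (j : Fin (n + 1)) :
    (univ.image f).erase (f j) = univ.image (f ∘ j.succAbove) := by
  rw [← coe_inj, coe_image_univ_erase hf, coe_image, coe_univ, Set.image_univ, Set.range_comp,
    Fin.range_succAbove]

theorem convexPos_iff {S : Finset (ℝ × ℝ)} :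
    ConvexPos S ↔ ∀ x ∈ S, x ∉ convexHull ℝ (S.erase x : Set (ℝ × ℝ)) :=
  forall₂_congr fun _ hx => mem_extremePoints_convexHull_finset_iff hx

theorem convexPos_image_univ_iff {ι : Type*} [Fintype ι] {g : ι → ℝ × ℝ}
    (hg : Function.Injective g) :
    ConvexPos (univ.image g) ↔ ∀ k, g k ∉ convexHull ℝ (g '' {k}ᶜ) := by
  simp only [convexPos_iff, mem_image, mem_univ, true_and, forall_exists_index,
    forall_apply_eq_imp_iff, coe_image_univ_erase hg]

/-- Carathéodory: a planar set of at least five points that is not in convex position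
remains so after omitting a suitable point. -/
theorem exists_erase_mem_convexHull {Q : Finset (ℝ × ℝ)} (hQ : 5 ≤ Q.card)
    (h : ¬ ConvexPos Q) :
    ∃ y ∈ Q, ∃ x ∈ Q.erase y, x ∈ convexHull ℝ ((Q.erase y).erase x : Set (ℝ × ℝ)) := by
  rw [convexPos_iff] at h
  push Not at h
  obtain ⟨x, hx, hmem⟩ := h
  rw [convexHull_eq_union] at hmem
  simp only [Set.mem_iUnion, coe_subset] at hmem
  obtain ⟨t, ht, hai, hxt⟩ := hmem
  have hcard : t.card ≤ 3 := by
    have h₁ := hai.card_le_finrank_succ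
    have h₂ := Submodule.finrank_le (vectorSpan ℝ (Set.range ((↑) : t → ℝ × ℝ)))
    simp only [Fintype.card_coe, Module.finrank_prod, Module.finrank_self] at h₁ h₂
    omega
  have hlt : t.card < (Q.erase x).card := by
    rw [card_erase_of_mem hx]
    omega
  obtain ⟨y, hy, hyt⟩ := exists_mem_notMem_of_card_lt_card hlt
  refine ⟨y, mem_of_mem_erase hy, x, mem_erase.2 ⟨(ne_of_mem_erase hy).symm, hx⟩, ?_⟩
  refine convexHull_mono (coe_subset.2 fun z hz => ?_) hxt
  have hz' := mem_erase.1 (ht hz)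
  exact mem_erase.2 ⟨hz'.1, mem_erase.2 ⟨fun e => hyt (e ▸ hz), hz'.2⟩⟩

open scoped Classical in
/-- The ordered pairs `(x, y)` of distinct points of `Q` such that `x` is a β-point and `y` is a
γ-point of `Q \ {x, y}`. -/
noncomputable def betaGammaPointPairs (Q : Finset (ℝ × ℝ)) : Finset ((ℝ × ℝ) × (ℝ × ℝ)) :=
  (Q ×ˢ Q).filter fun p =>
    p.1 ≠ p.2 ∧ IsBetaPt ((Q.erase p.2).erase p.1) p.1 ∧ IsGammaPt ((Q.erase p.2).erase p.1) p.2

theorem four_le_card_betaGammaPointPairs {Q : Finset (ℝ × ℝ)} (hgp : GenPos Q)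
    (hQ : Q.card = 5) (h : ¬ ConvexPos Q) : 4 ≤ (betaGammaPointPairs Q).card := by
  classical
  obtain ⟨f, hf, rfl⟩ : ∃ f : Fin 5 → ℝ × ℝ, Function.Injective f ∧ univ.image f = Q := by
    let e := (Q.equivFinOfCardEq hQ).symm
    refine ⟨fun i => e i, Subtype.val_injective.comp e.injective, ?_⟩
    ext x
    simp only [mem_image, mem_univ, true_and]
    exact ⟨fun ⟨i, hi⟩ => hi ▸ (e i).2, fun hx => ⟨e.symm ⟨x, hx⟩, by simp⟩⟩
  have hfj : ∀ j : Fin 5, Function.Injective (f ∘ j.succAbove) := fun j =>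
    hf.comp Fin.succAbove_right_injective
  have herase : ∀ (j : Fin 5) (k : Fin 4),
      ((((univ.image f).erase (f j)).erase (f (j.succAbove k)) : Finset (ℝ × ℝ)) : Set (ℝ × ℝ)) =
        (f ∘ j.succAbove) '' {k}ᶜ := by
    intro j k
    rw [image_univ_erase_succAbove hf, ← coe_image_univ_erase (hfj j) k]
    rfl
  have horient : ∀ i j k, i < j → j < k → orient (f i) (f j) (f k) ≠ 0 := by
    intro i j k hij hjk h0
    exact hgp (f i) (by simp) (f j) (by simp) (f k) (by simp) (hf.ne hij.ne)
      (hf.ne (hij.trans hjk).ne) (hf.ne hjk.ne) (collinear_of_orient_eq_zero h0)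
  have hex : ∃ (j : Fin 5) (k : Fin 4),
      f (j.succAbove k) ∈ convexHull ℝ ((f ∘ j.succAbove) '' {k}ᶜ) := by
    obtain ⟨y, hy, x, hx, hmem⟩ := exists_erase_mem_convexHull hQ.ge h
    obtain ⟨j, -, rfl⟩ := mem_image.1 hy
    have hx' := hx
    rw [image_univ_erase_succAbove hf] at hx'
    obtain ⟨k, -, rfl⟩ := mem_image.1 hx'
    exact ⟨j, k, by rwa [← herase]⟩
  refine (four_le_card_betaGammaPairs horient hex).trans
    (card_le_card_of_injOn (fun p => (f (p.1.succAbove p.2), f p.1)) ?_ ?_)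
  · rintro ⟨j, k⟩ hjk
    simp only [betaGammaPairs, mem_coe, mem_filter, mem_univ, true_and,
      decide_eq_true_eq, decide_eq_false_iff_not] at hjk
    obtain ⟨⟨k', hk'⟩, hk, hconv⟩ := hjk
    have hne : f (j.succAbove k) ≠ f j := hf.ne (Fin.succAbove_ne j k)
    refine mem_coe.2 (mem_filter.2 ⟨mem_product.2 ⟨by simp, by simp⟩, hne,
      ⟨?_, by rwa [herase]⟩, ?_⟩)
    · rw [insert_erase (mem_erase.2 ⟨hne, by simp⟩), image_univ_erase_succAbove hf,
        convexPos_image_univ_iff (hfj j)]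
      exact fun hall => hall k' hk'
    · rw [IsGammaPt, erase_right_comm, insert_erase (mem_erase.2 ⟨hne.symm, by simp⟩),
        image_univ_erase_succAbove hf, convexPos_image_univ_iff (hfj _)]
      exact hconv
  · rintro ⟨j, k⟩ - ⟨j', k'⟩ - he
    simp only [Prod.mk.injEq] at he
    obtain rfl := hf he.2
    rw [Fin.succAbove_right_injective (hf he.1)]

theorem four_mul_choose_five_le {P : Finset (ℝ × ℝ)} (hgp : GenPos P) :
    4 * P.card.choose 5 ≤
      4 * convexPosCount P 5 + ∑ T ∈ P.powersetCard 3, betaCount P T * gammaCount P T := by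
  classical
  have hsplit : convexPosCount P 5 + ((P.powersetCard 5).filter fun S => ¬ ConvexPos S).card =
      P.card.choose 5 := by
    rw [← card_powersetCard,
      ← card_filter_add_card_filter_not (s := P.powersetCard 5) (fun S => ConvexPos S)]
    unfold convexPosCount
    congr!
  have hbound : ((P.powersetCard 5).filter fun S => ¬ ConvexPos S).card * 4 ≤
      ∑ T ∈ P.powersetCard 3, betaCount P T * gammaCount P T := by
    calc _ ≤ ∑ Q ∈ (P.powersetCard 5).filter fun S => ¬ ConvexPos S,
          (betaGammaPointPairs Q).card := by
          rw [← smul_eq_mul]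
          refine card_nsmul_le_sum _ _ _ fun Q hQ => ?_
          obtain ⟨hQ, hconv⟩ := mem_filter.1 hQ
          obtain ⟨hsub, hcard⟩ := mem_powersetCard.1 hQ
          exact four_le_card_betaGammaPointPairs
            (fun x hx y hy z hz => hgp x (hsub hx) y (hsub hy) z (hsub hz)) hcard hconv
      _ = (((P.powersetCard 5).filter fun S => ¬ ConvexPos S).sigma
          fun Q => betaGammaPointPairs Q).card := (card_sigma _ _).symm
      _ ≤ ((P.powersetCard 3).sigma fun T => ((P \ T).filter fun x => IsBetaPt T x) ×ˢ
          ((P \ T).filter fun x => IsGammaPt T x)).card := by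
          refine card_le_card_of_injOn
            (fun p => ⟨(p.1.erase p.2.2).erase p.2.1, p.2⟩) ?_ ?_
          · rintro ⟨Q, x, y⟩ hp
            simp only [coe_sigma, Set.mem_sigma_iff, mem_coe, mem_filter, mem_powersetCard,
              betaGammaPointPairs, mem_product] at hp
            obtain ⟨⟨⟨hsub, hcard⟩, -⟩, ⟨hx, hy⟩, hne, hb, hg⟩ := hp
            simp only [coe_sigma, Set.mem_sigma_iff, mem_coe, mem_filter, mem_powersetCard,
              mem_product, mem_sdiff]
            refine ⟨⟨((erase_subset _ _).trans (erase_subset _ _)).trans hsub, ?_⟩,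
              ⟨⟨hsub hx, by simp⟩, hb⟩, ⟨hsub hy, by simp⟩, hg⟩
            rw [card_erase_of_mem (mem_erase.2 ⟨hne, hx⟩), card_erase_of_mem hy, hcard]
          · rintro ⟨Q, x, y⟩ hp ⟨Q', x', y'⟩ hp' he
            simp only [coe_sigma, Set.mem_sigma_iff, mem_coe, mem_filter, betaGammaPointPairs,
              mem_product] at hp hp'
            simp only [Sigma.mk.injEq, heq_eq_eq, Prod.mk.injEq] at he
            obtain ⟨hT, rfl, rfl⟩ := he
            have hQ := congrArg (fun T => insert y (insert x T)) hT
            beta_reduce at hQ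
            rw [insert_erase (mem_erase.2 ⟨hp.2.2.1, hp.2.1.1⟩), insert_erase hp.2.1.2,
              insert_erase (mem_erase.2 ⟨hp'.2.2.1, hp'.2.1.1⟩), insert_erase hp'.2.1.2] at hQ
            rw [hQ]
      _ = _ := by
          rw [card_sigma]
          refine sum_congr rfl fun T _ => ?_
          rw [card_product]
          unfold betaCount gammaCount
          congr!
  omega

/-- Covariance form of the Cauchy–Schwarz inequality for finite sums. -/
theorem sum_mul_le_add_sqrt_variance {ι : Type*} (s : Finset ι) (hs : s.Nonempty) (b g : ι → ℝ) :
    ∑ i ∈ s, b i * g i ≤ (∑ i ∈ s, b i) * (∑ i ∈ s, g i) / (s.card : ℝ) +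
      √((∑ i ∈ s, b i ^ 2 - (∑ i ∈ s, b i) ^ 2 / (s.card : ℝ)) *
        (∑ i ∈ s, g i ^ 2 - (∑ i ∈ s, g i) ^ 2 / (s.card : ℝ))) := by
  have hN : (s.card : ℝ) ≠ 0 := by exact_mod_cast hs.card_pos.ne'
  have hcov : ∀ u v : ι → ℝ,
      ∑ i ∈ s, (u i - (∑ j ∈ s, u j) / s.card) * (v i - (∑ j ∈ s, v j) / s.card) =
        ∑ i ∈ s, u i * v i - (∑ i ∈ s, u i) * (∑ i ∈ s, v i) / s.card := by
    intro u v
    simp only [sub_mul, mul_sub, sum_sub_distrib, ← sum_mul, ← mul_sum, sum_const, nsmul_eq_mul]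
    field_simp
    ring
  have hvar : ∀ u : ι → ℝ, ∑ i ∈ s, (u i - (∑ j ∈ s, u j) / s.card) ^ 2 =
      ∑ i ∈ s, u i ^ 2 - (∑ i ∈ s, u i) ^ 2 / s.card := by
    intro u
    simpa only [sq] using hcov u u
  rw [← sub_le_iff_le_add', ← hcov, ← hvar, ← hvar]
  exact Real.le_sqrt_of_sq_le (sum_mul_sq_le_sq_mul_sq _ _ _)

/-- Covariance-type inequality for the β- and γ-counts, and the resulting lower bound
on the number of convex pentagons. -/
theorem beta_gamma_covariance_bound (P : Finset (ℝ × ℝ)) (n : ℕ) (hgp : GenPos P)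
    (hcard : P.card = n) (hn : 3 ≤ n) :
    (∑ T ∈ P.powersetCard 3, (betaCount P T : ℝ) * (gammaCount P T : ℝ)) ≤
        (∑ T ∈ P.powersetCard 3, (betaCount P T : ℝ)) *
            (∑ T ∈ P.powersetCard 3, (gammaCount P T : ℝ)) / (n.choose 3 : ℝ) +
          Real.sqrt
            ((∑ T ∈ P.powersetCard 3, (betaCount P T : ℝ) ^ 2 -
                (∑ T ∈ P.powersetCard 3, (betaCount P T : ℝ)) ^ 2 / (n.choose 3 : ℝ)) *
              (∑ T ∈ P.powersetCard 3, (gammaCount P T : ℝ) ^ 2 -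
                (∑ T ∈ P.powersetCard 3, (gammaCount P T : ℝ)) ^ 2 / (n.choose 3 : ℝ))) ∧
    (4 * convexPosCount P 5 : ℝ) ≥
        4 * (n.choose 5 : ℝ) -
          (∑ T ∈ P.powersetCard 3, (betaCount P T : ℝ)) *
            (∑ T ∈ P.powersetCard 3, (gammaCount P T : ℝ)) / (n.choose 3 : ℝ) -
          Real.sqrt
            ((∑ T ∈ P.powersetCard 3, (betaCount P T : ℝ) ^ 2 -
                (∑ T ∈ P.powersetCard 3, (betaCount P T : ℝ)) ^ 2 / (n.choose 3 : ℝ)) *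
              (∑ T ∈ P.powersetCard 3, (gammaCount P T : ℝ) ^ 2 -
                (∑ T ∈ P.powersetCard 3, (gammaCount P T : ℝ)) ^ 2 / (n.choose 3 : ℝ))) := by
  have hcs := sum_mul_le_add_sqrt_variance (P.powersetCard 3)
    (powersetCard_nonempty.2 (hcard ▸ hn)) (fun T => (betaCount P T : ℝ))
    (fun T => (gammaCount P T : ℝ))
  rw [card_powersetCard, hcard] at hcs
  refine ⟨hcs, ?_⟩
  have hcount : (4 * n.choose 5 : ℝ) ≤ 4 * convexPosCount P 5 +
      ∑ T ∈ P.powersetCard 3, (betaCount P T : ℝ) * (gammaCount P T : ℝ) := by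
    exact_mod_cast hcard ▸ four_mul_choose_five_le hgp
  linarith
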